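/- arXiv:2601.20599 — 6 statements merged into one kernel-verified Lean document; each statement's English description precedes it below -/
import Mathlib

section
/- Let c > 0. For every θ ∈ ℝ^q there is a unique w ∈ ℝ^q satisfying the constraint Φᵀ D (R + γ P Φ θ − Φ θ + Φ w) = 0, namely w = −B⁻¹ (Mθ + b); moreover, for this w, (c/2) wᵀ B w + (1/2) θᵀ B θ = (c/2) ‖Π(R + γPΦθ − Φθ)‖²_D + (1/2) ‖Φθ‖²_D. Consequently, the constrained problem of minimizing (c/2) wᵀ B w + (1/2) θᵀ B θ over (θ, w) subject to this constraint has the same optimal θ as the unconstrained minimization of (c/2) ‖Π(R + γPΦθ − Φθ)‖²_D + (1/2) ‖Φθ‖²_D over θ. -/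
open Matrix

/-- A real matrix whose rank equals its number of columns acts injectively on vectors. -/
theorem Matrix.mulVec_injective_of_rank_eq {n q : ℕ} {Φ : Matrix (Fin n) (Fin q) ℝ}
    (hΦ : Φ.rank = q) : Function.Injective Φ.mulVec := by
  rw [Matrix.mulVec_injective_iff, linearIndependent_iff_card_eq_finrank_span,
    Set.finrank, ← Matrix.rank_eq_finrank_span_cols, hΦ, Fintype.card_fin]

/-- The Gram matrix of a full-column-rank matrix with respect to positive weights is positive
definite. -/
theorem Matrix.posDef_transpose_mul_diagonal_mul {n q : ℕ} {Φ : Matrix (Fin n) (Fin q) ℝ}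
    (hΦ : Φ.rank = q) {d : Fin n → ℝ} (hd : ∀ i, 0 < d i) :
    (Φᵀ * Matrix.diagonal d * Φ).PosDef := by
  rw [← Matrix.conjTranspose_eq_transpose_of_trivial]
  exact (Matrix.PosDef.diagonal hd).conjTranspose_mul_mul_same
    (Matrix.mulVec_injective_of_rank_eq hΦ)

/-- The weighted squared norm of `Φ v` is the quadratic form of the weighted Gram matrix. -/
theorem Matrix.mulVec_dotProduct_mulVec_mulVec {n q : ℕ} (Φ : Matrix (Fin n) (Fin q) ℝ)
    (D : Matrix (Fin n) (Fin n) ℝ) (v : Fin q → ℝ) :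
    Φ *ᵥ v ⬝ᵥ D *ᵥ (Φ *ᵥ v) = v ⬝ᵥ (Φᵀ * D * Φ) *ᵥ v := by
  rw [← Matrix.mulVec_mulVec, ← Matrix.mulVec_mulVec, Matrix.dotProduct_mulVec v,
    Matrix.vecMul_transpose]

/-- for each `θ` the constraint determines a unique `w`, for which the
constrained objective equals the unconstrained regularized-MSPBE objective; hence the
constrained and unconstrained problems have the same optimal `θ`'s. -/
theorem stmt_1 (n q : ℕ) (hn : 0 < n) (hq : 0 < q)
    (Φ : Matrix (Fin n) (Fin q) ℝ) (d : Fin n → ℝ) (hd : ∀ i, 0 < d i)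
    (P : Matrix (Fin n) (Fin n) ℝ) (R : Fin n → ℝ)
    (γ : ℝ) (hγ : 0 < γ ∧ γ < 1)
    (hΦ : Φ.rank = q)
    (M B : Matrix (Fin q) (Fin q) ℝ) (b : Fin q → ℝ)
    (hM : M = Φᵀ * Matrix.diagonal d * (γ • P - 1) * Φ)
    (hB : B = Φᵀ * Matrix.diagonal d * Φ)
    (hb : b = (Φᵀ * Matrix.diagonal d).mulVec R)
    (c : ℝ) (hc : 0 < c) :
    let Dm := Matrix.diagonal d
    let Pr := Φ * B⁻¹ * Φᵀ * Dm
    -- constrained objective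
    let f : (Fin q → ℝ) → (Fin q → ℝ) → ℝ := fun θ w =>
      (c / 2) * (w ⬝ᵥ B.mulVec w) + (1 / 2) * (θ ⬝ᵥ B.mulVec θ)
    -- the constraint
    let Cst : (Fin q → ℝ) → (Fin q → ℝ) → Prop := fun θ w =>
      (Φᵀ * Dm).mulVec
        (R + (γ • P).mulVec (Φ.mulVec θ) - Φ.mulVec θ + Φ.mulVec w) = 0
    -- unconstrained objective
    let J : (Fin q → ℝ) → ℝ := fun θ =>
      (c / 2) * (Pr.mulVec (R + (γ • P).mulVec (Φ.mulVec θ) - Φ.mulVec θ) ⬝ᵥ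
        Dm.mulVec (Pr.mulVec (R + (γ • P).mulVec (Φ.mulVec θ) - Φ.mulVec θ))) +
      (1 / 2) * (Φ.mulVec θ ⬝ᵥ Dm.mulVec (Φ.mulVec θ))
    -- unique `w` satisfying the constraint
    (∀ θ w, Cst θ w ↔ w = -(B⁻¹.mulVec (M.mulVec θ + b))) ∧
    -- value of the constrained objective at this `w`
    (∀ θ, f θ (-(B⁻¹.mulVec (M.mulVec θ + b))) = J θ) ∧
    -- same optimal `θ`'s
    ({θ | ∃ w, Cst θ w ∧ ∀ θ' w', Cst θ' w' → f θ w ≤ f θ' w'} =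
      {θ | ∀ θ', J θ ≤ J θ'}) := by
  intro Dm Pr f Cst J
  have hdet : IsUnit B.det := by
    rw [← Matrix.isUnit_iff_isUnit_det, hB]
    exact (Matrix.posDef_transpose_mul_diagonal_mul hΦ hd).isUnit
  have hres : ∀ θ, (Φᵀ * Dm) *ᵥ (R + (γ • P) *ᵥ (Φ *ᵥ θ) - Φ *ᵥ θ) = M *ᵥ θ + b := by
    intro θ
    rw [hM, hb, ← Matrix.mulVec_mulVec θ, ← Matrix.mulVec_mulVec (Φ *ᵥ θ), Matrix.sub_mulVec,
      Matrix.one_mulVec, ← Matrix.mulVec_add]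
    congr 1
    abel
  have hCst : ∀ θ w, Cst θ w ↔ w = -(B⁻¹ *ᵥ (M *ᵥ θ + b)) := by
    intro θ w
    change (Φᵀ * Dm) *ᵥ _ = 0 ↔ _
    rw [Matrix.mulVec_add, hres, Matrix.mulVec_mulVec, ← hB]
    constructor
    · intro h
      rw [eq_neg_of_add_eq_zero_left h, Matrix.mulVec_neg, neg_neg, Matrix.mulVec_mulVec,
        Matrix.nonsing_inv_mul B hdet, Matrix.one_mulVec]
    · rintro rfl
      rw [Matrix.mulVec_neg, Matrix.mulVec_mulVec, Matrix.mul_nonsing_inv B hdet,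
        Matrix.one_mulVec, add_neg_cancel]
  have hf : ∀ θ, f θ (-(B⁻¹ *ᵥ (M *ᵥ θ + b))) = J θ := by
    intro θ
    have hPr : Pr *ᵥ (R + (γ • P) *ᵥ (Φ *ᵥ θ) - Φ *ᵥ θ) = Φ *ᵥ (B⁻¹ *ᵥ (M *ᵥ θ + b)) := by
      simp only [Pr, ← hres, Matrix.mulVec_mulVec, Matrix.mul_assoc]
    simp only [f, J]
    rw [hPr, Matrix.mulVec_dotProduct_mulVec_mulVec Φ, Matrix.mulVec_dotProduct_mulVec_mulVec Φ,
      ← hB, Matrix.mulVec_neg, neg_dotProduct_neg]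
  refine ⟨hCst, hf, ?_⟩
  ext θ
  simp only [Set.mem_ofPred_eq, hCst, exists_eq_left, forall_eq, hf]
end

section
/- Let c > 0. A vector θ ∈ ℝ^q minimizes J(θ) := (c/2) ‖Π(R + γPΦθ − Φθ)‖²_D + (1/2) ‖Φθ‖²_D over ℝ^q if and only if (Mᵀ B⁻¹ M + c⁻¹ B) θ = −Mᵀ B⁻¹ b; consequently the unique minimizer of J is θ_RGTD(c) = −(G + c⁻¹ B)⁻¹ Mᵀ B⁻¹ b. -/
open Matrix

namespace Matrix

variable {m n : Type*} [Fintype m] [Fintype n]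

theorem mulVec_dotProduct_mulVec_mulVec_s2 (C : Matrix m n ℝ) (A : Matrix m m ℝ) (v : n → ℝ) :
    C *ᵥ v ⬝ᵥ A *ᵥ (C *ᵥ v) = v ⬝ᵥ (Cᵀ * A * C) *ᵥ v := by
  rw [← mulVec_mulVec, ← mulVec_mulVec, dotProduct_mulVec v, vecMul_transpose]

theorem IsSymm.dotProduct_mulVec_comm {A : Matrix n n ℝ} (hA : A.IsSymm) (v w : n → ℝ) :
    v ⬝ᵥ A *ᵥ w = w ⬝ᵥ A *ᵥ v := by
  rw [dotProduct_mulVec, ← mulVec_transpose, hA.eq, dotProduct_comm]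

/-- The quadratic polynomial `x ↦ xᵀ A x / 2 + xᵀ g` with `A` positive definite is minimized
exactly at `-A⁻¹ g`. -/
theorem PosDef.isMinimizer_quadratic_iff [DecidableEq n] {A : Matrix n n ℝ} (hA : A.PosDef)
    (g x : n → ℝ) :
    (∀ y, 1 / 2 * (x ⬝ᵥ A *ᵥ x) + x ⬝ᵥ g ≤ 1 / 2 * (y ⬝ᵥ A *ᵥ y) + y ⬝ᵥ g) ↔
      x = -(A⁻¹ *ᵥ g) := by
  have hsymm : A.IsSymm := by simpa [IsHermitian, IsSymm] using hA.isHermitian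
  obtain ⟨z, hz⟩ : ∃ z, z = -(A⁻¹ *ᵥ g) := ⟨_, rfl⟩
  have hg : g = -(A *ᵥ z) := by
    rw [hz, mulVec_neg, neg_neg, mulVec_mulVec,
      mul_nonsing_inv _ ((isUnit_iff_isUnit_det _).1 hA.isUnit), one_mulVec]
  have complete_square (y : n → ℝ) : 1 / 2 * (y ⬝ᵥ A *ᵥ y) + y ⬝ᵥ g =
      1 / 2 * ((y - z) ⬝ᵥ A *ᵥ (y - z)) - 1 / 2 * (z ⬝ᵥ A *ᵥ z) := by
    rw [hg, mulVec_sub, sub_dotProduct, dotProduct_sub, dotProduct_sub, dotProduct_neg,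
      hsymm.dotProduct_mulVec_comm z y]
    ring
  rw [← hz]
  simp only [complete_square]
  constructor
  · intro h
    by_contra hne
    have hpos := hA.dotProduct_mulVec_pos (sub_ne_zero.2 hne)
    have hle := h z
    simp only [star_trivial, sub_self, zero_dotProduct] at hpos hle
    linarith
  · rintro rfl y
    have hnonneg := hA.posSemidef.dotProduct_mulVec_nonneg (y - x)
    simp only [star_trivial] at hnonneg
    simp only [sub_self, zero_dotProduct]
    linarith

theorem PosDef.transpose_mul_diagonal_mul_of_rank [DecidableEq m] {C : Matrix m n ℝ}
    {d : m → ℝ} (hd : ∀ i, 0 < d i) (hC : C.rank = Fintype.card n) : (Cᵀ * diagonal d * C).PosDef := by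
  have hinj : Function.Injective C.mulVec := by
    rw [mulVec_injective_iff, linearIndependent_iff_card_eq_finrank_span,
      ← hC, rank_eq_finrank_span_cols]
    rfl
  simpa using (PosDef.diagonal hd).conjTranspose_mul_mul_same hinj

end Matrix

/-- first-order characterization of the minimizers of the regularized
objective `J`, and the closed-form unique minimizer `θ_RGTD(c)`. -/
theorem stmt_2 (n q : ℕ) (hn : 0 < n) (hq : 0 < q)
    (Φ : Matrix (Fin n) (Fin q) ℝ) (d : Fin n → ℝ) (hd : ∀ i, 0 < d i)
    (P : Matrix (Fin n) (Fin n) ℝ) (R : Fin n → ℝ)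
    (γ : ℝ) (hγ : 0 < γ ∧ γ < 1)
    (hΦ : Φ.rank = q)
    (M B : Matrix (Fin q) (Fin q) ℝ) (b : Fin q → ℝ)
    (hM : M = Φᵀ * Matrix.diagonal d * (γ • P - 1) * Φ)
    (hB : B = Φᵀ * Matrix.diagonal d * Φ)
    (hb : b = (Φᵀ * Matrix.diagonal d).mulVec R)
    (c : ℝ) (hc : 0 < c) :
    let Dm := Matrix.diagonal d
    let Pr := Φ * B⁻¹ * Φᵀ * Dm
    let G := Mᵀ * B⁻¹ * M
    let J : (Fin q → ℝ) → ℝ := fun θ =>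
      (c / 2) * (Pr.mulVec (R + (γ • P).mulVec (Φ.mulVec θ) - Φ.mulVec θ) ⬝ᵥ
        Dm.mulVec (Pr.mulVec (R + (γ • P).mulVec (Φ.mulVec θ) - Φ.mulVec θ))) +
      (1 / 2) * (Φ.mulVec θ ⬝ᵥ Dm.mulVec (Φ.mulVec θ))
    let θRGTD : Fin q → ℝ := -((G + c⁻¹ • B)⁻¹.mulVec ((Mᵀ * B⁻¹).mulVec b))
    -- minimizers of `J` are exactly the solutions of the normal equation
    (∀ θ, (∀ θ', J θ ≤ J θ') ↔
      (Mᵀ * B⁻¹ * M + c⁻¹ • B).mulVec θ = -((Mᵀ * B⁻¹).mulVec b)) ∧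
    -- consequently `θ_RGTD(c)` is the unique minimizer of `J`
    (∀ θ, (∀ θ', J θ ≤ J θ') ↔ θ = θRGTD) := by
  intro Dm Pr G J θRGTD
  have hBpos : B.PosDef := hB ▸ PosDef.transpose_mul_diagonal_mul_of_rank hd (by simpa using hΦ)
  have hBdet : IsUnit B.det := (isUnit_iff_isUnit_det _).1 hBpos.isUnit
  have hBinv : B⁻¹.IsSymm := by simpa [IsHermitian, IsSymm] using hBpos.inv.isHermitian
  have hApos : (G + c⁻¹ • B).PosDef := by
    refine PosDef.posSemidef_add ?_ (hBpos.smul (inv_pos.2 hc))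
    simpa using hBpos.inv.posSemidef.conjTranspose_mul_mul_same M
  have hJ (θ : Fin q → ℝ) : J θ =
      c * (1 / 2 * (θ ⬝ᵥ (G + c⁻¹ • B) *ᵥ θ) + θ ⬝ᵥ (Mᵀ * B⁻¹) *ᵥ b) +
        c / 2 * (b ⬝ᵥ B⁻¹ *ᵥ b) := by
    have hPr : Pr *ᵥ (R + (γ • P) *ᵥ (Φ *ᵥ θ) - Φ *ᵥ θ) = Φ *ᵥ (B⁻¹ *ᵥ (M *ᵥ θ + b)) := by
      have hres : M *ᵥ θ + b = (Φᵀ * Dm) *ᵥ (R + (γ • P) *ᵥ (Φ *ᵥ θ) - Φ *ᵥ θ) := by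
        rw [hM, hb, ← mulVec_mulVec, ← mulVec_mulVec, ← mulVec_add, sub_mulVec, one_mulVec]
        congr 1
        abel
      rw [hres]
      simp only [Pr, mulVec_mulVec, Matrix.mul_assoc]
    have hcross : M *ᵥ θ ⬝ᵥ B⁻¹ *ᵥ b = θ ⬝ᵥ (Mᵀ * B⁻¹) *ᵥ b := by
      rw [← mulVec_mulVec, dotProduct_mulVec θ, vecMul_transpose]
    simp only [J]
    rw [hPr, mulVec_dotProduct_mulVec_mulVec_s2, mulVec_dotProduct_mulVec_mulVec_s2 Φ, ← hB,
      mulVec_mulVec, mul_nonsing_inv _ hBdet, one_mulVec, dotProduct_comm, mulVec_add,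
      dotProduct_add, add_dotProduct, add_dotProduct, mulVec_dotProduct_mulVec_mulVec_s2,
      hBinv.dotProduct_mulVec_comm b, hcross, add_mulVec, dotProduct_add, smul_mulVec,
      dotProduct_smul, smul_eq_mul]
    simp only [G]
    field_simp
    ring
  have hmin (θ : Fin q → ℝ) : (∀ θ', J θ ≤ J θ') ↔ θ = θRGTD := by
    simp only [hJ, add_le_add_iff_right, mul_le_mul_iff_right₀ hc]
    exact hApos.isMinimizer_quadratic_iff _ θ
  refine ⟨fun θ => (hmin θ).trans ?_, hmin⟩
  have hAdet : IsUnit (G + c⁻¹ • B).det := (isUnit_iff_isUnit_det _).1 hApos.isUnit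
  constructor
  · rintro rfl
    change (G + c⁻¹ • B) *ᵥ θRGTD = _
    simp only [θRGTD]
    rw [mulVec_neg, mulVec_mulVec, mul_nonsing_inv _ hAdet, one_mulVec]
  · intro h
    change (G + c⁻¹ • B) *ᵥ θ = _ at h
    simp only [θRGTD]
    rw [← mulVec_neg, ← h, mulVec_mulVec, nonsing_inv_mul _ hAdet, one_mulVec]
end

section
/- For every θ ∈ ℝ^q, the mean-square projected Bellman error admits the quadratic form (1/2) ‖Π(R + γPΦθ) − Φθ‖²_D = (1/2) (Mθ + b)ᵀ B⁻¹ (Mθ + b). -/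
open Matrix

/-- A real matrix with full column rank has a positive definite weighted Gram matrix for every
positive diagonal weight. -/
theorem posDef_transpose_mul_diagonal_mul_of_rank_eq {m k : Type*} [Fintype m] [Fintype k]
    [DecidableEq m] {A : Matrix m k ℝ} {d : m → ℝ}
    (hd : ∀ i, 0 < d i) (hA : A.rank = Fintype.card k) :
    (Aᵀ * Matrix.diagonal d * A).PosDef := by
  have hinj : Function.Injective A.mulVec := by
    rw [Matrix.mulVec_injective_iff, linearIndependent_iff_card_eq_finrank_span,
      Set.finrank, ← Matrix.rank_eq_finrank_span_cols, hA]
  rw [← Matrix.conjTranspose_eq_transpose_of_trivial]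
  exact (Matrix.PosDef.diagonal hd).conjTranspose_mul_mul_same hinj

/-- the MSPBE admits the quadratic form
`(1/2) ‖Π(R + γPΦθ) − Φθ‖²_D = (1/2) (Mθ + b)ᵀ B⁻¹ (Mθ + b)`. -/
theorem stmt_4 (n q : ℕ) (hn : 0 < n) (hq : 0 < q)
    (Φ : Matrix (Fin n) (Fin q) ℝ) (d : Fin n → ℝ) (hd : ∀ i, 0 < d i)
    (P : Matrix (Fin n) (Fin n) ℝ) (R : Fin n → ℝ)
    (γ : ℝ) (hγ : 0 < γ ∧ γ < 1)
    (hΦ : Φ.rank = q)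
    (M B : Matrix (Fin q) (Fin q) ℝ) (b : Fin q → ℝ)
    (hM : M = Φᵀ * Matrix.diagonal d * (γ • P - 1) * Φ)
    (hB : B = Φᵀ * Matrix.diagonal d * Φ)
    (hb : b = (Φᵀ * Matrix.diagonal d).mulVec R) :
    ∀ θ : Fin q → ℝ,
      (1 / 2) *
        ((Φ * B⁻¹ * Φᵀ * Matrix.diagonal d).mulVec
            (R + (γ • P).mulVec (Φ.mulVec θ)) - Φ.mulVec θ) ⬝ᵥ
          (Matrix.diagonal d).mulVec
            (((Φ * B⁻¹ * Φᵀ * Matrix.diagonal d).mulVec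
              (R + (γ • P).mulVec (Φ.mulVec θ)) - Φ.mulVec θ)) =
      (1 / 2) * (M.mulVec θ + b) ⬝ᵥ B⁻¹.mulVec (M.mulVec θ + b) := by
  intro θ
  have hdet : IsUnit B.det := by
    rw [hB]
    exact (posDef_transpose_mul_diagonal_mul_of_rank_eq hd (by simpa using hΦ)).det_pos.ne'.isUnit
  have hres : (Φ * B⁻¹ * Φᵀ * Matrix.diagonal d).mulVec
      (R + (γ • P).mulVec (Φ.mulVec θ)) - Φ.mulVec θ
      = Φ.mulVec (B⁻¹.mulVec (M.mulVec θ + b)) := by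
    have hMθ : M.mulVec θ + b = (Φᵀ * Matrix.diagonal d).mulVec
        (R + (γ • P).mulVec (Φ.mulVec θ)) - B.mulVec θ := by
      rw [hM, hb, hB, Matrix.mul_sub, Matrix.sub_mul, Matrix.mul_one, Matrix.sub_mulVec,
        Matrix.mulVec_add, Matrix.mulVec_mulVec, Matrix.mulVec_mulVec]
      abel
    rw [hMθ, Matrix.mulVec_sub, Matrix.mulVec_mulVec θ B⁻¹ B, Matrix.nonsing_inv_mul B hdet,
      Matrix.one_mulVec, Matrix.mulVec_sub, Matrix.mulVec_mulVec _ B⁻¹,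
      Matrix.mulVec_mulVec _ Φ]
    simp only [Matrix.mul_assoc]
  rw [hres]
  set w := M.mulVec θ + b
  have hw : B.mulVec (B⁻¹.mulVec w) = w := by
    rw [Matrix.mulVec_mulVec, Matrix.mul_nonsing_inv B hdet, Matrix.one_mulVec]
  have hgram (x : Fin q → ℝ) :
      Φ.mulVec x ⬝ᵥ (Matrix.diagonal d).mulVec (Φ.mulVec x) = B.mulVec x ⬝ᵥ x := by
    rw [dotProduct_comm (B.mulVec x), hB, Matrix.mul_assoc, ← Matrix.mulVec_mulVec,
      ← Matrix.mulVec_mulVec, Matrix.dotProduct_mulVec x, Matrix.vecMul_transpose]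
  rw [hgram, hw]
end

section
/- Suppose M is nonsingular, and set θ_GTD2 := −G⁻¹ Mᵀ B⁻¹ b and K := G⁻¹ B G⁻¹ Mᵀ B⁻¹ b. Then lim_{c→∞} c · (θ_RGTD(c) − θ_GTD2) = K; in particular θ_RGTD(c) = θ_GTD2 + (1/c) K + o(1/c) as c → ∞. -/
open Matrix Filter

/-- First-order expansion of the inverse of `G + c⁻¹ • B` as `c → ∞`. -/
theorem tendsto_smul_inv_sub_inv_add_smul {ι : Type*} [Fintype ι] [DecidableEq ι]
    {G : Matrix ι ι ℝ} (hG : IsUnit G) (B : Matrix ι ι ℝ) :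
    Tendsto (fun c : ℝ => c • (G⁻¹ - (G + c⁻¹ • B)⁻¹)) atTop (nhds (G⁻¹ * B * G⁻¹)) := by
  have hadd : Tendsto (fun c : ℝ => G + c⁻¹ • B) atTop (nhds G) := by
    simpa using tendsto_const_nhds.add
      ((tendsto_inv_atTop_zero (𝕜 := ℝ)).smul (tendsto_const_nhds (x := B)))
  have hdetG : G.det ≠ 0 := ((Matrix.isUnit_iff_isUnit_det G).mp hG).ne_zero
  have hinv : Tendsto (fun c : ℝ => (G + c⁻¹ • B)⁻¹) atTop (nhds G⁻¹) := by
    refine (continuousAt_matrix_inv G ?_).tendsto.comp hadd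
    rw [Ring.inverse_eq_inv']
    exact continuousAt_inv₀ hdetG
  have hdet : ∀ᶠ c : ℝ in atTop, (G + c⁻¹ • B).det ≠ 0 :=
    ((continuous_id.matrix_det.tendsto G).comp hadd).eventually_ne hdetG
  refine ((hinv.mul_const B).mul_const G⁻¹).congr' ?_
  filter_upwards [hdet, eventually_ne_atTop 0] with c hc hc0
  have hdiff : G⁻¹ - (G + c⁻¹ • B)⁻¹ = (G + c⁻¹ • B)⁻¹ * (c⁻¹ • B) * G⁻¹ := by
    have h := Matrix.mul_nonsing_inv G hdetG.isUnit
    have h' := Matrix.nonsing_inv_mul (G + c⁻¹ • B) hc.isUnit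
    calc G⁻¹ - (G + c⁻¹ • B)⁻¹
        = (G + c⁻¹ • B)⁻¹ * (G + c⁻¹ • B) * G⁻¹ - (G + c⁻¹ • B)⁻¹ * (G * G⁻¹) := by
          rw [h, h', Matrix.one_mul, Matrix.mul_one]
      _ = (G + c⁻¹ • B)⁻¹ * (c⁻¹ • B) * G⁻¹ := by noncomm_ring
  rw [hdiff]
  simp [smul_smul, hc0]

/-- when `M` is nonsingular,
`lim_{c→∞} c (θ_RGTD(c) − θ_GTD2) = K`; in particular
`θ_RGTD(c) = θ_GTD2 + (1/c) K + o(1/c)` as `c → ∞`. -/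
theorem stmt_10 (n q : ℕ) (hn : 0 < n) (hq : 0 < q)
    (Φ : Matrix (Fin n) (Fin q) ℝ) (d : Fin n → ℝ) (hd : ∀ i, 0 < d i)
    (P : Matrix (Fin n) (Fin n) ℝ) (R : Fin n → ℝ)
    (γ : ℝ) (hγ : 0 < γ ∧ γ < 1)
    (hΦ : Φ.rank = q)
    (M B : Matrix (Fin q) (Fin q) ℝ) (b : Fin q → ℝ)
    (hM : M = Φᵀ * Matrix.diagonal d * (γ • P - 1) * Φ)
    (hB : B = Φᵀ * Matrix.diagonal d * Φ)
    (hb : b = (Φᵀ * Matrix.diagonal d).mulVec R)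
    (hMns : IsUnit M) :
    let G := Mᵀ * B⁻¹ * M
    let θRGTD : ℝ → (Fin q → ℝ) := fun c =>
      -((G + c⁻¹ • B)⁻¹.mulVec ((Mᵀ * B⁻¹).mulVec b))
    let θGTD2 : Fin q → ℝ := -(G⁻¹.mulVec ((Mᵀ * B⁻¹).mulVec b))
    let K : Fin q → ℝ := (G⁻¹ * B * G⁻¹ * Mᵀ * B⁻¹).mulVec b
    Tendsto (fun c : ℝ => c • (θRGTD c - θGTD2)) atTop (nhds K) ∧
    (fun c : ℝ => θRGTD c - θGTD2 - c⁻¹ • K) =o[atTop] fun c : ℝ => c⁻¹ := by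
  intro G θRGTD θGTD2 K
  have hΦinj : Function.Injective Φ.mulVec := by
    refine Function.Injective.of_comp
      (f := (Φᵀ * Matrix.diagonal d * (γ • P - 1)).mulVec) ?_
    have hcomp : (Φᵀ * Matrix.diagonal d * (γ • P - 1)).mulVec ∘ Φ.mulVec = M.mulVec := by
      funext x
      simp only [Function.comp_apply, Matrix.mulVec_mulVec, hM]
    rw [hcomp]
    exact Matrix.mulVec_injective_of_isUnit hMns
  have hBunit : IsUnit B := by
    have h := (Matrix.PosDef.diagonal hd).conjTranspose_mul_mul_same hΦinj
    rw [Matrix.conjTranspose_eq_transpose_of_trivial, ← hB] at h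
    exact h.isUnit
  have hG : IsUnit G :=
    (((Matrix.isUnit_transpose M).mpr hMns).mul (Matrix.isUnit_nonsing_inv_iff.mpr hBunit)).mul hMns
  have hlim : Tendsto (fun c : ℝ => c • (θRGTD c - θGTD2)) atTop (nhds K) := by
    have h := ((continuous_id.matrix_mulVec
      (continuous_const (y := (Mᵀ * B⁻¹).mulVec b))).tendsto _).comp
        (tendsto_smul_inv_sub_inv_add_smul hG B)
    convert h using 1
    · funext c
      simp only [θRGTD, θGTD2, Function.comp_apply, id, Matrix.smul_mulVec, Matrix.sub_mulVec]
      congr 1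
      abel
    · simp only [K, id, Matrix.mulVec_mulVec, Matrix.mul_assoc]
  refine ⟨hlim, ?_⟩
  have hzero : (fun c : ℝ => c • (θRGTD c - θGTD2) - K) =o[atTop] fun _ : ℝ => (1 : ℝ) :=
    (Asymptotics.isLittleO_one_iff ℝ).mpr (tendsto_sub_nhds_zero_iff.mpr hlim)
  refine ((Asymptotics.isBigO_refl (fun c : ℝ => c⁻¹) atTop).smul_isLittleO hzero).congr' ?_ ?_
  · filter_upwards [eventually_ne_atTop 0] with c hc
    rw [smul_sub, smul_smul, inv_mul_cancel₀ hc, one_smul]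
  · exact Eventually.of_forall fun c => by simp
end

section
/- Suppose M is singular, and let Θ := {θ ∈ ℝ^q : Mᵀ B⁻¹ (Mθ + b) = 0} denote the (nonempty, affine) GTD2 solution set. Then there exist constants C ≥ 0 and c₀ > 0 such that for all c > c₀, the Euclidean distance from Φ θ_RGTD(c) to the set {Φ θ̄ : θ̄ ∈ Θ} satisfies inf_{θ̄ ∈ Θ} ‖Φ θ_RGTD(c) − Φ θ̄‖₂ ≤ C / c. -/
open Matrix

namespace Matrix

variable {m n : Type*} [Fintype m] [Fintype n]

/-- A vector orthogonal to the kernel of `H` lies in the range of `Hᵀ`. -/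
lemma exists_transpose_mulVec_eq (H : Matrix m n ℝ) (v : n → ℝ)
    (h : ∀ x, H *ᵥ x = 0 → v ⬝ᵥ x = 0) : ∃ w, Hᵀ *ᵥ w = v := by
  classical
  have hspan : dotProductBilin ℝ ℝ v ∈
      Submodule.span ℝ (Set.range fun i => dotProductBilin ℝ ℝ (H i)) := by
    refine mem_span_of_iInf_ker_le_ker fun x hx => ?_
    simp only [Submodule.mem_iInf, LinearMap.mem_ker] at hx ⊢
    exact h x (funext hx)
  obtain ⟨w, hw⟩ := (Submodule.mem_span_range_iff_exists_fun ℝ).1 hspan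
  refine ⟨w, funext fun j => ?_⟩
  have hj := LinearMap.congr_fun hw (Pi.single j 1)
  simpa [mulVec, dotProduct, dotProductBilin, Pi.single_apply, mul_comm] using hj

/-- The range of `Mᵀ` is contained in the range of `G B⁻¹ G`, where `G = Mᵀ B⁻¹ M`. -/
lemma PosDef.exists_gram_mul_inv_mul_gram_mulVec_eq [DecidableEq n] {B : Matrix n n ℝ}
    (hB : B.PosDef) (M : Matrix n n ℝ) (y : n → ℝ) :
    ∃ w, (Mᵀ * B⁻¹ * M * B⁻¹ * (Mᵀ * B⁻¹ * M)) *ᵥ w = Mᵀ *ᵥ y := by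
  have ker_gram (A : Matrix n n ℝ) (x : n → ℝ) (hx : (Aᵀ * B⁻¹ * A) *ᵥ x = 0) :
      A *ᵥ x = 0 := by
    by_contra hne
    have hpos := hB.inv.dotProduct_mulVec_pos hne
    have hzero : x ⬝ᵥ ((Aᵀ * B⁻¹ * A) *ᵥ x) = 0 := by simp [hx]
    rw [← mulVec_mulVec, ← mulVec_mulVec, dotProduct_mulVec, vecMul_transpose] at hzero
    exact hpos.ne' (by simpa using hzero)
  have hBt : B⁻¹ᵀ = B⁻¹ := by simpa using hB.inv.isHermitian.eq
  have hHt : ((Mᵀ * B⁻¹ * M)ᵀ * B⁻¹ * (Mᵀ * B⁻¹ * M))ᵀ =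
      Mᵀ * B⁻¹ * M * B⁻¹ * (Mᵀ * B⁻¹ * M) := by
    simp [transpose_mul, hBt, Matrix.mul_assoc]
  obtain ⟨w, hw⟩ := exists_transpose_mulVec_eq
    ((Mᵀ * B⁻¹ * M)ᵀ * B⁻¹ * (Mᵀ * B⁻¹ * M)) (Mᵀ *ᵥ y) fun x hx => by
      have hMx := ker_gram M x (ker_gram _ x hx)
      rw [mulVec_transpose, ← dotProduct_mulVec, hMx, dotProduct_zero]
  exact ⟨w, hHt ▸ hw⟩

/-- The regularized solution operator `ε (G + ε B)⁻¹ B` is a contraction in the `B`-norm. -/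
lemma PosSemidef.dotProduct_mulVec_le_of_add_smul {G B : Matrix n n ℝ}
    (hG : G.PosSemidef) (hB : B.PosSemidef) {ε : ℝ} (hε : 0 < ε) {v w : n → ℝ}
    (h : (G + ε • B) *ᵥ v = ε • (B *ᵥ w)) : v ⬝ᵥ (B *ᵥ v) ≤ w ⬝ᵥ (B *ᵥ w) := by
  have hGv : 0 ≤ v ⬝ᵥ (G *ᵥ v) := by simpa using hG.dotProduct_mulVec_nonneg v
  have hdiff : 0 ≤ (v - w) ⬝ᵥ (B *ᵥ (v - w)) := by
    simpa using hB.dotProduct_mulVec_nonneg (v - w)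
  have hBt : Bᵀ = B := by simpa using hB.isHermitian.eq
  have hsymm : w ⬝ᵥ (B *ᵥ v) = v ⬝ᵥ (B *ᵥ w) := by
    rw [dotProduct_mulVec, ← mulVec_transpose, hBt, dotProduct_comm]
  have henergy := congrArg (v ⬝ᵥ ·) h
  simp only [add_mulVec, smul_mulVec, dotProduct_add, dotProduct_smul, smul_eq_mul] at henergy
  simp only [mulVec_sub, dotProduct_sub, sub_dotProduct, hsymm] at hdiff
  have hle : v ⬝ᵥ (B *ᵥ v) ≤ v ⬝ᵥ (B *ᵥ w) := le_of_mul_le_mul_left (by linarith) hε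
  linarith

/-- The Euclidean norm of `Φ v` is controlled by the weighted quadratic form `vᵀ Φᵀ D Φ v`. -/
lemma norm_toLp_mulVec_le_of_weighted [DecidableEq m] (Φ : Matrix m n ℝ) {d : m → ℝ}
    (hd : ∀ i, 0 < d i) {v : n → ℝ} {K : ℝ}
    (hv : v ⬝ᵥ ((Φᵀ * diagonal d * Φ) *ᵥ v) ≤ K) :
    ‖WithLp.toLp 2 (Φ *ᵥ v)‖ ≤ √(∑ i, K / d i) := by
  rw [EuclideanSpace.norm_eq]
  refine Real.sqrt_le_sqrt (Finset.sum_le_sum fun i _ => ?_)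
  rw [← mulVec_mulVec, ← mulVec_mulVec, dotProduct_mulVec, vecMul_transpose] at hv
  have hterm : (Φ *ᵥ v) i * (d i * (Φ *ᵥ v) i) ≤ K := by
    refine le_trans ?_ hv
    simp only [dotProduct, mulVec_diagonal]
    refine Finset.single_le_sum (f := fun i => (Φ *ᵥ v) i * (d i * (Φ *ᵥ v) i))
      (fun j _ => ?_) (Finset.mem_univ i)
    nlinarith [mul_nonneg (hd j).le (mul_self_nonneg ((Φ *ᵥ v) j))]
  rw [le_div_iff₀ (hd i), Real.norm_eq_abs, sq_abs]
  linarith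

lemma mulVec_injective_of_rank_eq_card {m n : Type*} [Fintype n] (Φ : Matrix m n ℝ)
    (h : Φ.rank = Fintype.card n) :
    Function.Injective Φ.mulVec := by
  rw [mulVec_injective_iff, linearIndependent_iff_card_eq_finrank_span, ← h,
    rank_eq_finrank_span_cols]
  rfl

end Matrix

/-- singular case — the Euclidean distance from `Φ θ_RGTD(c)` to the
image `Φ Θ` of the GTD2 solution set is `O(1/c)`. -/
theorem stmt_16 (n q : ℕ) (hn : 0 < n) (hq : 0 < q)
    (Φ : Matrix (Fin n) (Fin q) ℝ) (d : Fin n → ℝ) (hd : ∀ i, 0 < d i)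
    (P : Matrix (Fin n) (Fin n) ℝ) (R : Fin n → ℝ)
    (γ : ℝ) (hγ : 0 < γ ∧ γ < 1)
    (hΦ : Φ.rank = q)
    (M B : Matrix (Fin q) (Fin q) ℝ) (b : Fin q → ℝ)
    (hM : M = Φᵀ * Matrix.diagonal d * (γ • P - 1) * Φ)
    (hB : B = Φᵀ * Matrix.diagonal d * Φ)
    (hb : b = (Φᵀ * Matrix.diagonal d).mulVec R)
    (hMsing : ¬ IsUnit M) :
    let G := Mᵀ * B⁻¹ * M
    let θRGTD : ℝ → (Fin q → ℝ) := fun c =>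
      -((G + c⁻¹ • B)⁻¹.mulVec ((Mᵀ * B⁻¹).mulVec b))
    let Θ : Set (Fin q → ℝ) := {θ | (Mᵀ * B⁻¹).mulVec (M.mulVec θ + b) = 0}
    let e : (Fin n → ℝ) → EuclideanSpace ℝ (Fin n) := (WithLp.equiv 2 (Fin n → ℝ)).symm
    ∃ C : ℝ, 0 ≤ C ∧ ∃ c₀ : ℝ, 0 < c₀ ∧ ∀ c : ℝ, c₀ < c →
      Metric.infDist (e (Φ.mulVec (θRGTD c))) ((fun θ' => e (Φ.mulVec θ')) '' Θ) ≤
        C / c := by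
  intro G θRGTD Θ e
  have hBpd : B.PosDef := by
    rw [hB]
    simpa using (PosDef.diagonal hd).conjTranspose_mul_mul_same
      (mulVec_injective_of_rank_eq_card Φ (by simpa using hΦ))
  have hGpsd : G.PosSemidef := by
    simpa [G] using hBpd.inv.posSemidef.conjTranspose_mul_mul_same M
  have hBunit : IsUnit B.det := (isUnit_iff_isUnit_det B).1 hBpd.isUnit
  obtain ⟨w, hw⟩ := hBpd.exists_gram_mul_inv_mul_gram_mulVec_eq M (B⁻¹ *ᵥ b)
  rw [mulVec_mulVec] at hw
  set θbar : Fin q → ℝ := -(B⁻¹ *ᵥ (G *ᵥ w)) with hθbar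
  have hGθ : G *ᵥ θbar = -((Mᵀ * B⁻¹) *ᵥ b) := by
    rw [hθbar, ← hw, mulVec_neg, mulVec_mulVec, mulVec_mulVec, ← Matrix.mul_assoc]
  have hBθ : B *ᵥ θbar = -(G *ᵥ w) := by
    rw [hθbar, mulVec_neg, mulVec_mulVec, mul_nonsing_inv B hBunit, one_mulVec]
  have hmem : θbar ∈ Θ := by
    change (Mᵀ * B⁻¹) *ᵥ (M *ᵥ θbar + b) = 0
    rw [mulVec_add, mulVec_mulVec]
    change G *ᵥ θbar + _ = 0
    rw [hGθ, neg_add_cancel]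
  set S := √(∑ i, (w ⬝ᵥ (B *ᵥ w)) / d i)
  refine ⟨S + S, by positivity, 1, one_pos, fun c hc => ?_⟩
  have hc0 : 0 < c := one_pos.trans hc
  have hreg : (G + c⁻¹ • B).PosDef :=
    PosDef.posSemidef_add hGpsd (hBpd.smul (inv_pos.2 hc0))
  have hθc : (G + c⁻¹ • B) *ᵥ θRGTD c = -((Mᵀ * B⁻¹) *ᵥ b) := by
    change _ *ᵥ (-_) = _
    rw [mulVec_neg, mulVec_mulVec,
      mul_nonsing_inv _ ((isUnit_iff_isUnit_det _).1 hreg.isUnit), one_mulVec]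
  set v : Fin q → ℝ := w - c • (θRGTD c - θbar) with hv
  have hveq : (G + c⁻¹ • B) *ᵥ v = c⁻¹ • (B *ᵥ w) := by
    rw [hv, mulVec_sub, mulVec_smul, mulVec_sub, hθc]
    simp only [add_mulVec, smul_mulVec, hGθ, hBθ]
    ext i
    simp only [Pi.sub_apply, Pi.add_apply, Pi.smul_apply, Pi.neg_apply, smul_eq_mul]
    field_simp
    ring
  have hvle := hGpsd.dotProduct_mulVec_le_of_add_smul hBpd.posSemidef (inv_pos.2 hc0) hveq
  have hdiff : θRGTD c - θbar = c⁻¹ • (w - v) := by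
    rw [hv, sub_sub_cancel, inv_smul_smul₀ hc0.ne']
  have hnorm (x : Fin q → ℝ) (hx : x ⬝ᵥ (B *ᵥ x) ≤ w ⬝ᵥ (B *ᵥ w)) :
      ‖WithLp.toLp 2 (Φ *ᵥ x)‖ ≤ S :=
    norm_toLp_mulVec_le_of_weighted Φ hd (by rwa [← hB])
  calc Metric.infDist (e (Φ *ᵥ θRGTD c)) ((fun θ' => e (Φ *ᵥ θ')) '' Θ)
      ≤ dist (e (Φ *ᵥ θRGTD c)) (e (Φ *ᵥ θbar)) :=
        Metric.infDist_le_dist_of_mem ⟨θbar, hmem, rfl⟩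
    _ = ‖WithLp.toLp 2 (Φ *ᵥ (θRGTD c - θbar))‖ := by
        rw [dist_eq_norm, mulVec_sub, WithLp.toLp_sub]; rfl
    _ = c⁻¹ * ‖WithLp.toLp 2 (Φ *ᵥ w) - WithLp.toLp 2 (Φ *ᵥ v)‖ := by
        rw [hdiff, mulVec_smul, mulVec_sub, WithLp.toLp_smul, WithLp.toLp_sub, norm_smul,
          Real.norm_of_nonneg (inv_pos.2 hc0).le]
    _ ≤ c⁻¹ * (S + S) := by
        gcongr
        exact (norm_sub_le _ _).trans (add_le_add (hnorm w le_rfl) (hnorm v hvle))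
    _ = (S + S) / c := by rw [div_eq_inv_mul]
end

section
/- Suppose M is singular. Let Θ := {θ ∈ ℝ^q : Mᵀ B⁻¹ (Mθ + b) = 0} denote the (nonempty, affine) GTD2 solution set, let S := {Φ θ̄ : θ̄ ∈ Θ} (an affine subspace of ℝⁿ), and let Π_S denote the Euclidean orthogonal projection onto S. Then there exist constants C ≥ 0 and c₀ > 0 such that for all c > c₀: ‖Φ θ_RGTD(c) − Φ θ*‖₂ ≤ dist(Φ θ*, S) + ‖Π_S(Φ θ_RGTD(c)) − Π_S(Φ θ*)‖₂ + C / c, where dist(x, S) := inf_{y ∈ S} ‖x − y‖₂. -/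
open Matrix

/-- A vector orthogonal to the kernel of a real symmetric matrix lies in its range. -/
theorem exists_mulVec_eq_of_orthogonal_ker {m : Type*} [Fintype m] [DecidableEq m]
    {A : Matrix m m ℝ} (hA : A.IsHermitian) {g : m → ℝ}
    (hg : ∀ x, A *ᵥ x = 0 → g ⬝ᵥ x = 0) : ∃ w, A *ᵥ w = g := by
  have hsymm := isSymmetric_toEuclideanLin_iff.2 hA
  have hmem : WithLp.toLp 2 g ∈ (LinearMap.range (toEuclideanLin A))ᗮᗮ := by
    rw [hsymm.orthogonal_range, Submodule.mem_orthogonal]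
    intro x hx
    have hx' : A *ᵥ x.ofLp = 0 := by
      simpa using congrArg WithLp.ofLp (LinearMap.mem_ker.1 hx)
    simpa [EuclideanSpace.inner_eq_star_dotProduct] using hg _ hx'
  rw [Submodule.orthogonal_orthogonal] at hmem
  obtain ⟨w, hw⟩ := hmem
  exact ⟨w.ofLp, by simpa using congrArg WithLp.ofLp hw⟩

/-- The regularized solution operator `(A + t B)⁻¹ A` is nonexpansive in the `B`-norm. -/
theorem dotProduct_mulVec_le_of_ridge {m : Type*} [Fintype m] {A B : Matrix m m ℝ}
    (hA : A.PosSemidef) (hB : B.PosSemidef) {t : ℝ} (ht : 0 < t) {u w : m → ℝ}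
    (h : (A + t • B) *ᵥ u = A *ᵥ w) : u ⬝ᵥ B *ᵥ u ≤ w ⬝ᵥ B *ᵥ w := by
  have hdiff : A *ᵥ (w - u) = t • B *ᵥ u := by
    rw [mulVec_sub, ← h, add_mulVec, smul_mulVec, add_sub_cancel_left]
  have hAnonneg := hA.dotProduct_mulVec_nonneg (w - u)
  have hBnonneg := hB.dotProduct_mulVec_nonneg (w - u)
  have hcomm : u ⬝ᵥ B *ᵥ w = w ⬝ᵥ B *ᵥ u := by
    rw [dotProduct_mulVec, ← mulVec_transpose, ← conjTranspose_eq_transpose_of_trivial,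
      hB.isHermitian.eq, dotProduct_comm]
  rw [hdiff, star_trivial, dotProduct_smul, smul_eq_mul] at hAnonneg
  have hcross := nonneg_of_mul_nonneg_right hAnonneg ht
  simp only [star_trivial, mulVec_sub, sub_dotProduct, dotProduct_sub] at hcross hBnonneg
  linarith

theorem Matrix.PosSemidef.transpose_mul_inv_mul {m : Type*} [Fintype m] [DecidableEq m]
    {B : Matrix m m ℝ} (hB : B.PosSemidef) (M : Matrix m m ℝ) :
    (Mᵀ * B⁻¹ * M).PosSemidef := by
  simpa [conjTranspose_eq_transpose_of_trivial] using hB.inv.conjTranspose_mul_mul_same M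

theorem Matrix.PosDef.mulVec_eq_zero_of_congruence {k m : Type*} [Fintype k] [Fintype m]
    {B : Matrix k k ℝ} (hB : B.PosDef) {M : Matrix k m ℝ} {x : m → ℝ}
    (h : (Mᵀ * B * M) *ᵥ x = 0) : M *ᵥ x = 0 := by
  by_contra hx
  have hpos := hB.dotProduct_mulVec_pos hx
  have hzero : x ⬝ᵥ (Mᵀ * B * M) *ᵥ x = 0 := by rw [h, dotProduct_zero]
  rw [← mulVec_mulVec, ← mulVec_mulVec, dotProduct_mulVec, vecMul_transpose] at hzero
  rw [star_trivial, hzero] at hpos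
  exact lt_irrefl _ hpos

/-- The regularized solutions differ from a fixed least-squares solution by `c⁻¹` times a vector
whose `B`-norm is bounded independently of `c`. -/
theorem exists_regularized_solution_expansion {m : Type*} [Fintype m] [DecidableEq m]
    {B : Matrix m m ℝ} (hB : B.PosDef) (M : Matrix m m ℝ) (b : m → ℝ) :
    ∃ θ w : m → ℝ, (Mᵀ * B⁻¹) *ᵥ (M *ᵥ θ + b) = 0 ∧ ∀ c : ℝ, 0 < c → ∃ u : m → ℝ,
      -((Mᵀ * B⁻¹ * M + c⁻¹ • B)⁻¹ *ᵥ ((Mᵀ * B⁻¹) *ᵥ b)) = θ - c⁻¹ • u ∧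
        u ⬝ᵥ B *ᵥ u ≤ w ⬝ᵥ B *ᵥ w := by
  set G := Mᵀ * B⁻¹ * M with hGdef
  have hG : G.PosSemidef := hB.posSemidef.transpose_mul_inv_mul M
  have hGT : Gᵀ = G := by
    rw [← conjTranspose_eq_transpose_of_trivial, hG.isHermitian.eq]
  have hBinvT : B⁻¹ᵀ = B⁻¹ := by
    rw [← conjTranspose_eq_transpose_of_trivial, hB.inv.isHermitian.eq]
  obtain ⟨w, hw⟩ : ∃ w, (Gᵀ * B⁻¹ * G) *ᵥ w = -((Mᵀ * B⁻¹) *ᵥ b) := by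
    refine exists_mulVec_eq_of_orthogonal_ker
      (hB.posSemidef.transpose_mul_inv_mul G).isHermitian fun x hx => ?_
    have hMx : M *ᵥ x = 0 :=
      hB.inv.mulVec_eq_zero_of_congruence (hB.inv.mulVec_eq_zero_of_congruence hx)
    rw [neg_dotProduct, dotProduct_comm, dotProduct_mulVec, ← mulVec_transpose, transpose_mul,
      transpose_transpose, hBinvT, ← mulVec_mulVec, hMx, mulVec_zero, zero_dotProduct, neg_zero]
  rw [hGT] at hw
  have hθ : G *ᵥ ((B⁻¹ * G) *ᵥ w) = -((Mᵀ * B⁻¹) *ᵥ b) := by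
    rw [mulVec_mulVec, ← Matrix.mul_assoc, hw]
  refine ⟨(B⁻¹ * G) *ᵥ w, w, ?_, fun c hc => ?_⟩
  · rw [mulVec_add, mulVec_mulVec, ← hGdef, hθ, neg_add_cancel]
  have hc' : 0 < c⁻¹ := inv_pos.2 hc
  have hH : (G + c⁻¹ • B).PosDef := PosDef.posSemidef_add hG (hB.smul hc')
  have hHdet := (isUnit_iff_isUnit_det _).1 hH.isUnit
  have hBdet := (isUnit_iff_isUnit_det _).1 hB.isUnit
  set H := G + c⁻¹ • B with hHdef
  refine ⟨H⁻¹ *ᵥ (G *ᵥ w), ?_, ?_⟩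
  · have hBθ : B *ᵥ ((B⁻¹ * G) *ᵥ w) = G *ᵥ w := by
      rw [mulVec_mulVec, mul_nonsing_inv_cancel_left _ _ hBdet]
    have hsplit : -((Mᵀ * B⁻¹) *ᵥ b) = H *ᵥ ((B⁻¹ * G) *ᵥ w) - c⁻¹ • (G *ᵥ w) := by
      rw [hHdef, add_mulVec, smul_mulVec, hBθ, hθ, add_sub_cancel_right]
    rw [← mulVec_neg, hsplit, mulVec_sub, mulVec_smul, mulVec_mulVec, nonsing_inv_mul _ hHdet,
      one_mulVec]
  · refine dotProduct_mulVec_le_of_ridge hG hB.posSemidef hc' ?_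
    rw [mulVec_mulVec, mul_nonsing_inv _ hHdet, one_mulVec]

/-- The Euclidean norm is controlled by a weighted Euclidean norm with positive weights. -/
theorem norm_toLp_le_sqrt_of_weighted_sum_le {ι : Type*} [Fintype ι] {d : ι → ℝ}
    (hd : ∀ i, 0 < d i) {x : ι → ℝ} {K : ℝ} (h : ∑ i, d i * x i ^ 2 ≤ K) :
    ‖WithLp.toLp 2 x‖ ≤ √(∑ i, K / d i) := by
  rw [EuclideanSpace.norm_eq]
  refine Real.sqrt_le_sqrt (Finset.sum_le_sum fun i _ => ?_)
  rw [Real.norm_eq_abs, sq_abs, le_div_iff₀ (hd i), mul_comm]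
  exact (Finset.single_le_sum (f := fun i => d i * x i ^ 2)
    (fun j _ => mul_nonneg (hd j).le (sq_nonneg _)) (Finset.mem_univ i)).trans h

theorem dotProduct_gram_diagonal_mulVec {k m : Type*} [Fintype k] [Fintype m] [DecidableEq k]
    (Φ : Matrix k m ℝ) (d : k → ℝ) (u : m → ℝ) :
    u ⬝ᵥ (Φᵀ * diagonal d * Φ) *ᵥ u = ∑ i, d i * (Φ *ᵥ u) i ^ 2 := by
  rw [← mulVec_mulVec, ← mulVec_mulVec, dotProduct_mulVec, vecMul_transpose]
  refine Finset.sum_congr rfl fun i _ => ?_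
  rw [mulVec_diagonal]
  ring

theorem mulVec_injective_of_rank_eq_card {k m : Type*} [Fintype k] [Fintype m]
    {Φ : Matrix k m ℝ} (h : Φ.rank = Fintype.card m) : Function.Injective Φ.mulVec := by
  rw [mulVec_injective_iff, linearIndependent_iff_card_eq_finrank_span, ← h,
    rank_eq_finrank_span_cols, Set.finrank]


/-- singular case — error bound between `Φ θ_RGTD(c)` and the true
projected solution `Φ θ*` in terms of the distance from `Φ θ*` to the affine set
`S = Φ Θ` and the distance between the orthogonal projections (characterized as
the closest points in `S`) of `Φ θ_RGTD(c)` and `Φ θ*` onto `S`. -/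
theorem stmt_18 (n q : ℕ) (hn : 0 < n) (hq : 0 < q)
    (Φ : Matrix (Fin n) (Fin q) ℝ) (d : Fin n → ℝ) (hd : ∀ i, 0 < d i)
    (P : Matrix (Fin n) (Fin n) ℝ) (R : Fin n → ℝ)
    (γ : ℝ) (hγ : 0 < γ ∧ γ < 1)
    (hΦ : Φ.rank = q)
    (hPnonneg : ∀ i j, 0 ≤ P i j) (hProw : ∀ i, ∑ j, P i j = 1)
    (M B : Matrix (Fin q) (Fin q) ℝ) (b : Fin q → ℝ)
    (hM : M = Φᵀ * Matrix.diagonal d * (γ • P - 1) * Φ)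
    (hB : B = Φᵀ * Matrix.diagonal d * Φ)
    (hb : b = (Φᵀ * Matrix.diagonal d).mulVec R)
    (hMsing : ¬ IsUnit M) :
    let G := Mᵀ * B⁻¹ * M
    let θRGTD : ℝ → (Fin q → ℝ) := fun c =>
      -((G + c⁻¹ • B)⁻¹.mulVec ((Mᵀ * B⁻¹).mulVec b))
    let Θ : Set (Fin q → ℝ) := {θ | (Mᵀ * B⁻¹).mulVec (M.mulVec θ + b) = 0}
    let e : (Fin n → ℝ) → EuclideanSpace ℝ (Fin n) := (WithLp.equiv 2 (Fin n → ℝ)).symm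
    let S : Set (EuclideanSpace ℝ (Fin n)) := (fun θ' => e (Φ.mulVec θ')) '' Θ
    let V : Fin n → ℝ := (1 - γ • P)⁻¹.mulVec R
    let θstar : Fin q → ℝ := B⁻¹.mulVec ((Φᵀ * Matrix.diagonal d).mulVec V)
    ∃ C : ℝ, 0 ≤ C ∧ ∃ c₀ : ℝ, 0 < c₀ ∧ ∀ c : ℝ, c₀ < c →
      ∀ p pstar : EuclideanSpace ℝ (Fin n),
        -- `p` is the orthogonal projection of `Φ θ_RGTD(c)` onto `S`
        (p ∈ S ∧ ∀ y ∈ S, dist (e (Φ.mulVec (θRGTD c))) p ≤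
            dist (e (Φ.mulVec (θRGTD c))) y) →
        -- `pstar` is the orthogonal projection of `Φ θ*` onto `S`
        (pstar ∈ S ∧ ∀ y ∈ S, dist (e (Φ.mulVec θstar)) pstar ≤
            dist (e (Φ.mulVec θstar)) y) →
        ‖e (Φ.mulVec (θRGTD c)) - e (Φ.mulVec θstar)‖ ≤
          Metric.infDist (e (Φ.mulVec θstar)) S + ‖p - pstar‖ + C / c := by
  intro G θRGTD Θ e S V θstar
  have hBpos : B.PosDef := by
    rw [hB, ← conjTranspose_eq_transpose_of_trivial]
    exact (PosDef.diagonal hd).conjTranspose_mul_mul_same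
      (mulVec_injective_of_rank_eq_card (by simpa using hΦ))
  obtain ⟨θ, w, hθ, hexp⟩ := exists_regularized_solution_expansion hBpos M b
  refine ⟨√(∑ i, w ⬝ᵥ B *ᵥ w / d i), Real.sqrt_nonneg _, 1, one_pos, ?_⟩
  rintro c hc p pstar ⟨-, hpmin⟩ ⟨hpstar, hpstarmin⟩
  have hc0 : 0 < c := one_pos.trans hc
  obtain ⟨u, hu, hubound⟩ := hexp c hc0
  have hnear : dist (e (Φ *ᵥ θRGTD c)) (e (Φ *ᵥ θ)) ≤ √(∑ i, w ⬝ᵥ B *ᵥ w / d i) / c := by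
    have hsub : e (Φ *ᵥ θRGTD c) - e (Φ *ᵥ θ) = -(c⁻¹ • WithLp.toLp 2 (Φ *ᵥ u)) := by
      change WithLp.toLp 2 (Φ *ᵥ (-((Mᵀ * B⁻¹ * M + c⁻¹ • B)⁻¹ *ᵥ ((Mᵀ * B⁻¹) *ᵥ b)))) -
        WithLp.toLp 2 (Φ *ᵥ θ) = _
      rw [hu, ← WithLp.toLp_sub, ← mulVec_sub, sub_sub_cancel_left, mulVec_neg, mulVec_smul,
        WithLp.toLp_neg, WithLp.toLp_smul]
    rw [dist_eq_norm, hsub, norm_neg, norm_smul, Real.norm_of_nonneg (inv_pos.2 hc0).le,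
      inv_mul_eq_div]
    gcongr
    refine norm_toLp_le_sqrt_of_weighted_sum_le hd ?_
    rwa [← dotProduct_gram_diagonal_mulVec, ← hB]
  have hp := (hpmin (e (Φ *ᵥ θ)) ⟨θ, hθ, rfl⟩).trans hnear
  have hinf : dist (e (Φ *ᵥ θstar)) pstar ≤ Metric.infDist (e (Φ *ᵥ θstar)) S :=
    (Metric.le_infDist ⟨pstar, hpstar⟩).2 fun y hy => hpstarmin y hy
  have htri := dist_triangle4 (e (Φ *ᵥ θRGTD c)) p pstar (e (Φ *ᵥ θstar))
  rw [dist_comm pstar, dist_eq_norm p] at htri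
  rw [← dist_eq_norm]
  linarith
end
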